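/- arXiv:1506.08852 — 3 statements merged into one kernel-verified Lean document; each statement's English description precedes it below -/
import Mathlib

section
/- Unbiasedness of the ν-step locally weighted Metropolis–Hastings estimator: for every integer ν ≥ 1 and every bounded measurable h : S → ℝ, ∫_S ∫_S [ (P(x,y)ᵛ)₀₀ · h(x) + (P(x,y)ᵛ)₀₁ · h(y) ] · π(x) k(y; x) dμ(y) dμ(x) = ∫_S h(x) π(x) dμ(x), where (P(x,y)ᵛ)₀₀ and (P(x,y)ᵛ)₀₁ are the entries of the first row of the ν-th power of P(x,y). In particular, weighting the current point and the proposal by the first row of P(x,y)ᵛ gives an unbiased estimator of ∫ h π dμ when the current point is distributed according to π. -/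
open MeasureTheory

/-- The two-state Metropolis–Hastings transition matrix `P(x,y)` built from a
target density `π` and a proposal density `k`, where `k x y` denotes `k(y; x)`
(the density of proposing `y` from the current point `x`); the convention
`min{1, c/0} = 1` is used for acceptance probabilities. -/
noncomputable def mhPairMatrix {S : Type*} (π : S → ℝ) (k : S → S → ℝ) (x y : S) :
    Matrix (Fin 2) (Fin 2) ℝ :=
  let β := π x * k x y   -- β(x,y) = π(x) k(y;x)
  let α := π y * k y x   -- α(x,y) = π(y) k(x;y)
  let r01 := if β = 0 then 1 else min 1 (α / β)
  let r10 := if α = 0 then 1 else min 1 (β / α)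
  !![1 - r01, r01; r10, 1 - r10]

/-- Powers of a two-state stochastic matrix, via the geometric sum of its second eigenvalue. -/
theorem twoState_pow (a b : ℝ) (n : ℕ) :
    (!![1 - a, a; b, 1 - b] : Matrix (Fin 2) (Fin 2) ℝ) ^ n =
      !![1 - a * ∑ j ∈ Finset.range n, (1 - a - b) ^ j, a * ∑ j ∈ Finset.range n, (1 - a - b) ^ j;
        b * ∑ j ∈ Finset.range n, (1 - a - b) ^ j,
        1 - b * ∑ j ∈ Finset.range n, (1 - a - b) ^ j] := by
  induction n with
  | zero => simp [Matrix.one_fin_two]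
  | succ n ih =>
    rw [pow_succ, ih, geom_sum_succ, Matrix.mul_fin_two]
    ext i j
    fin_cases i <;> fin_cases j <;> simp <;> ring

/-- The Metropolis–Hastings acceptance probability for the flows `β` (forward) and `α`
(backward), equal to `1` when `β = 0`. -/
noncomputable def acceptProb (β α : ℝ) : ℝ := if β = 0 then 1 else min 1 (α / β)

theorem acceptProb_nonneg {β α : ℝ} (hβ : 0 ≤ β) (hα : 0 ≤ α) : 0 ≤ acceptProb β α := by
  unfold acceptProb
  split_ifs <;> positivity

theorem acceptProb_le_one (β α : ℝ) : acceptProb β α ≤ 1 := by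
  unfold acceptProb
  split_ifs <;> simp

theorem mul_acceptProb {β α : ℝ} (hβ : 0 ≤ β) (hα : 0 ≤ α) :
    β * acceptProb β α = min β α := by
  unfold acceptProb
  split_ifs with h
  · simp [h, hα]
  · rw [mul_min_of_nonneg _ _ hβ, mul_one, mul_div_cancel₀ _ h]

theorem measurable_acceptProb : Measurable fun p : ℝ × ℝ => acceptProb p.1 p.2 := by
  unfold acceptProb
  exact Measurable.ite (measurable_fst (measurableSet_singleton 0)) measurable_const
    (measurable_const.min (measurable_snd.div measurable_fst))

/-- The geometric sum governing the `n`-th power of the Metropolis–Hastings pair matrix. -/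
noncomputable def acceptGeomSum (n : ℕ) (β α : ℝ) : ℝ :=
  ∑ j ∈ Finset.range n, (1 - acceptProb β α - acceptProb α β) ^ j

theorem acceptGeomSum_comm (n : ℕ) (β α : ℝ) : acceptGeomSum n β α = acceptGeomSum n α β := by
  simp only [acceptGeomSum, sub_right_comm]

theorem abs_acceptGeomSum_le (n : ℕ) {β α : ℝ} (hβ : 0 ≤ β) (hα : 0 ≤ α) :
    |acceptGeomSum n β α| ≤ n := by
  have h : |1 - acceptProb β α - acceptProb α β| ≤ 1 := by
    rw [abs_le]
    constructor <;>
      linarith [acceptProb_nonneg hβ hα, acceptProb_nonneg hα hβ, acceptProb_le_one β α,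
        acceptProb_le_one α β]
  calc |acceptGeomSum n β α|
      ≤ ∑ j ∈ Finset.range n, |(1 - acceptProb β α - acceptProb α β) ^ j| :=
        Finset.abs_sum_le_sum_abs _ _
    _ ≤ ∑ _j ∈ Finset.range n, (1 : ℝ) := by
        gcongr with j
        rw [abs_pow]
        exact pow_le_one₀ (abs_nonneg _) h
    _ = n := by simp

theorem measurable_acceptGeomSum (n : ℕ) :
    Measurable fun p : ℝ × ℝ => acceptGeomSum n p.1 p.2 := by
  have h := measurable_acceptProb
  have h' : Measurable fun p : ℝ × ℝ => acceptProb p.2 p.1 := h.comp measurable_swap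
  unfold acceptGeomSum
  fun_prop

theorem mhPairMatrix_pow {S : Type*} (π : S → ℝ) (k : S → S → ℝ) (x y : S) (n : ℕ) :
    (mhPairMatrix π k x y ^ n) 0 0 =
        1 - acceptProb (π x * k x y) (π y * k y x) *
          acceptGeomSum n (π x * k x y) (π y * k y x) ∧
      (mhPairMatrix π k x y ^ n) 0 1 =
        acceptProb (π x * k x y) (π y * k y x) *
          acceptGeomSum n (π x * k x y) (π y * k y x) := by
  have h : mhPairMatrix π k x y =
      !![1 - acceptProb (π x * k x y) (π y * k y x), acceptProb (π x * k x y) (π y * k y x);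
        acceptProb (π y * k y x) (π x * k x y),
        1 - acceptProb (π y * k y x) (π x * k x y)] := rfl
  rw [h, twoState_pow]
  exact ⟨rfl, rfl⟩

/-- The integral of an antisymmetric function over a square vanishes. -/
theorem integral_prod_eq_zero_of_antisymm {S : Type*} [MeasurableSpace S] (μ : Measure S)
    [SFinite μ] {F : S × S → ℝ} (hF : ∀ p, F p.swap = -F p) : ∫ p, F p ∂μ.prod μ = 0 := by
  have h := integral_prod_swap (μ := μ) (ν := μ) F
  simp only [hF, integral_neg] at h
  linarith

/-- The joint density of a point with density `π` and its proposal is integrable. -/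
theorem integrable_mul_proposal {S : Type*} [MeasurableSpace S] {μ : Measure S} [SFinite μ]
    {π : S → ℝ} (hπ : Integrable π μ) (hπ_meas : Measurable π)
    {k : S → S → ℝ} (hk_meas : Measurable fun p : S × S => k p.1 p.2)
    (hk_nonneg : ∀ x y, 0 ≤ k x y) (hk_int : ∀ x, ∫ y, k x y ∂μ = 1) :
    Integrable (fun p : S × S => π p.1 * k p.1 p.2) (μ.prod μ) := by
  have hm : Measurable fun p : S × S => π p.1 * k p.1 p.2 :=
    (hπ_meas.comp measurable_fst).mul hk_meas
  rw [integrable_prod_iff hm.aestronglyMeasurable]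
  refine ⟨.of_forall fun x => ?_, ?_⟩
  · have hk : Integrable (k x) μ := .of_integral_ne_zero (by simp [hk_int])
    exact hk.const_mul (π x)
  · simpa [abs_mul, abs_of_nonneg (hk_nonneg _ _), integral_const_mul, hk_int] using hπ.abs

/-- unbiasedness of the ν-step locally weighted Metropolis–Hastings
estimator.  For every integer `ν ≥ 1` and every bounded measurable `h : S → ℝ`,
`∫∫ [ (P(x,y)ᵛ)₀₀ h(x) + (P(x,y)ᵛ)₀₁ h(y) ] π(x) k(y;x) dμ(y) dμ(x) = ∫ h π dμ`,
i.e. weighting the current point and the proposal by the first row of `P(x,y)ᵛ`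
gives an unbiased estimator of `∫ h π dμ` when the current point is distributed
according to `π`. -/
theorem lwmcmc_nu_step_unbiased {S : Type*} [MeasurableSpace S]
    (μ : Measure S) [SigmaFinite μ]
    (π : S → ℝ) (hπ_meas : Measurable π) (hπ_nonneg : ∀ x, 0 ≤ π x)
    (hπ_int : ∫ x, π x ∂μ = 1)
    (k : S → S → ℝ) (hk_meas : Measurable fun p : S × S => k p.1 p.2)
    (hk_nonneg : ∀ x y, 0 ≤ k x y) (hk_int : ∀ x, ∫ y, k x y ∂μ = 1)
    (ν : ℕ) (hν : 1 ≤ ν)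
    (h : S → ℝ) (hh_meas : Measurable h) (hh_bdd : ∃ C, ∀ x, |h x| ≤ C) :
    ∫ x, ∫ y,
        ((mhPairMatrix π k x y ^ ν) 0 0 * h x + (mhPairMatrix π k x y ^ ν) 0 1 * h y)
          * (π x * k x y) ∂μ ∂μ
      = ∫ x, h x * π x ∂μ := by
  obtain ⟨C, hC⟩ := hh_bdd
  have hπ : Integrable π μ := .of_integral_ne_zero (by simp [hπ_int])
  have hβ := integrable_mul_proposal hπ hπ_meas hk_meas hk_nonneg hk_int
  have hβ_nonneg (x y : S) : 0 ≤ π x * k x y := mul_nonneg (hπ_nonneg x) (hk_nonneg x y)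
  have hβ_meas : Measurable fun p : S × S => π p.1 * k p.1 p.2 :=
    (hπ_meas.comp measurable_fst).mul hk_meas
  have hα_meas : Measurable fun p : S × S => π p.2 * k p.2 p.1 := hβ_meas.comp measurable_swap
  let F : S × S → ℝ := fun p =>
    min (π p.1 * k p.1 p.2) (π p.2 * k p.2 p.1) *
      acceptGeomSum ν (π p.1 * k p.1 p.2) (π p.2 * k p.2 p.1) * (h p.2 - h p.1)
  have hF_meas : Measurable F :=
    ((hβ_meas.min hα_meas).mul ((measurable_acceptGeomSum ν).comp (hβ_meas.prodMk hα_meas))).mul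
      ((hh_meas.comp measurable_snd).sub (hh_meas.comp measurable_fst))
  have hF : Integrable F (μ.prod μ) := by
    refine (hβ.mul_const (ν * (C + C))).mono' hF_meas.aestronglyMeasurable
      (.of_forall fun p => ?_)
    rw [Real.norm_eq_abs, abs_mul, abs_mul,
      abs_of_nonneg (le_min (hβ_nonneg _ _) (hβ_nonneg _ _)), mul_assoc]
    have hβp := hβ_nonneg p.1 p.2
    gcongr
    · exact min_le_left _ _
    · exact abs_acceptGeomSum_le ν (hβ_nonneg _ _) (hβ_nonneg _ _)
    · exact (abs_sub _ _).trans (add_le_add (hC _) (hC _))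
  have hF_zero : ∫ p, F p ∂μ.prod μ = 0 := by
    refine integral_prod_eq_zero_of_antisymm μ fun p => ?_
    simp only [F, Prod.fst_swap, Prod.snd_swap]
    rw [min_comm, acceptGeomSum_comm]
    ring
  have hG : Integrable (fun p : S × S => h p.1 * (π p.1 * k p.1 p.2)) (μ.prod μ) :=
    hβ.bdd_mul (hh_meas.comp measurable_fst).aestronglyMeasurable (.of_forall fun p => hC p.1)
  have hsplit (x y : S) :
      ((mhPairMatrix π k x y ^ ν) 0 0 * h x + (mhPairMatrix π k x y ^ ν) 0 1 * h y)
          * (π x * k x y) = h x * (π x * k x y) + F (x, y) := by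
    obtain ⟨h₀, h₁⟩ := mhPairMatrix_pow π k x y ν
    simp only [F, h₀, h₁, ← mul_acceptProb (hβ_nonneg x y) (hβ_nonneg y x)]
    ring
  simp only [hsplit]
  rw [integral_integral (f := fun x y => h x * (π x * k x y) + F (x, y)) (hG.add hF),
    integral_add hG hF, hF_zero, add_zero, integral_prod _ hG]
  simp only [integral_const_mul, hk_int, mul_one]
end

section
/- Symmetry (swap) lemma for the multi-proposal acceptance weights: for every fixed i ∈ {1, …, M} and every bounded measurable h : S → ℝ, ∫_{S^{M+1}} min{q₀(x), q_i(x)} · h(x_i) dμ^{⊗(M+1)}(x) = ∫_{S^{M+1}} min{q₀(x), q_i(x)} · h(x₀) dμ^{⊗(M+1)}(x). -/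
open MeasureTheory

/-- `mpQ π k i x = q_i(x) = π(x_i) k(x_{−i}; x_i)`, where `x ∈ S^{M+1}` and
`x_{−i}` is the vector of the remaining `M` coordinates (in order), and
`k y x` denotes the one-to-M proposal density `k(y₁,…,y_M; x)`. -/
noncomputable def mpQ {S : Type*} {M : ℕ} (π : S → ℝ) (k : (Fin M → S) → S → ℝ)
    (i : Fin (M + 1)) (x : Fin (M + 1) → S) : ℝ :=
  π (x i) * k (fun j => x (i.succAbove j)) (x i)

/-- If `k` is exchangeable in its proposals, then permuting the coordinates of `x` permutes the
weights `q_i(x)` accordingly. -/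
theorem mpQ_comp_perm {S : Type*} {M : ℕ} (π : S → ℝ) (k : (Fin M → S) → S → ℝ)
    (hk_symm : ∀ (σ : Equiv.Perm (Fin M)) (y : Fin M → S) (x : S), k (y ∘ σ) x = k y x)
    (τ : Equiv.Perm (Fin (M + 1))) (i : Fin (M + 1)) (x : Fin (M + 1) → S) :
    mpQ π k i (x ∘ τ) = mpQ π k (τ i) x := by
  let σ : Equiv.Perm (Fin M) :=
    ((finSuccAboveEquiv i).trans (τ.subtypeEquiv (q := (· ≠ τ i)) fun a => by simp)).trans
      (finSuccAboveEquiv (τ i)).symm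
  have hσ (j : Fin M) : (τ i).succAbove (σ j) = τ (i.succAbove j) :=
    congrArg Subtype.val ((finSuccAboveEquiv (τ i)).apply_symm_apply
      (τ.subtypeEquiv (q := (· ≠ τ i)) (fun a => by simp) (finSuccAboveEquiv i j)))
  have hy : (fun j => (x ∘ τ) (i.succAbove j)) = (fun j => x ((τ i).succAbove j)) ∘ σ := by
    funext j
    simp [hσ]
  rw [mpQ, hy, hk_symm]
  rfl

/-- Permuting the coordinates leaves integrals against a power of a `σ`-finite measure unchanged. -/
theorem integral_pi_comp_perm {ι S E : Type*} [Fintype ι] [MeasurableSpace S]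
    [NormedAddCommGroup E] [NormedSpace ℝ E] (μ : Measure S) [SigmaFinite μ]
    (τ : Equiv.Perm ι) (f : (ι → S) → E) :
    ∫ x, f (x ∘ τ) ∂(Measure.pi fun _ : ι => μ) = ∫ x, f x ∂(Measure.pi fun _ : ι => μ) := by
  have hx (x : ι → S) : MeasurableEquiv.piCongrLeft (fun _ => S) τ.symm x = x ∘ τ := by
    funext j
    simpa [MeasurableEquiv.coe_piCongrLeft] using
      Equiv.piCongrLeft_apply_apply (fun _ : ι => S) τ.symm x (τ j)
  simpa only [hx] using
    (measurePreserving_piCongrLeft (fun _ : ι => μ) τ.symm).integral_comp' f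

/-- symmetry (swap) lemma for the multi-proposal acceptance
weights.  For every fixed `i ∈ {1, …, M}` and every bounded measurable
`h : S → ℝ`,
`∫_{S^{M+1}} min{q₀(x), q_i(x)} h(x_i) dμ^{⊗(M+1)}(x)
  = ∫_{S^{M+1}} min{q₀(x), q_i(x)} h(x₀) dμ^{⊗(M+1)}(x)`. -/
theorem mp_min_swap {S : Type*} [MeasurableSpace S]
    (μ : Measure S) [SigmaFinite μ]
    (π : S → ℝ) (hπ_meas : Measurable π) (hπ_nonneg : ∀ x, 0 ≤ π x)
    (hπ_int : ∫ x, π x ∂μ = 1)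
    (M : ℕ) (hM : 1 ≤ M)
    (k : (Fin M → S) → S → ℝ)
    (hk_meas : Measurable fun p : (Fin M → S) × S => k p.1 p.2)
    (hk_nonneg : ∀ y x, 0 ≤ k y x)
    (hk_int : ∀ x : S, ∫ y, k y x ∂(Measure.pi fun _ : Fin M => μ) = 1)
    (hk_symm : ∀ (σ : Equiv.Perm (Fin M)) (y : Fin M → S) (x : S), k (y ∘ σ) x = k y x)
    (i : Fin (M + 1)) (hi : i ≠ 0)
    (h : S → ℝ) (hh_meas : Measurable h) (hh_bdd : ∃ C, ∀ x, |h x| ≤ C) :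
    ∫ x, min (mpQ π k 0 x) (mpQ π k i x) * h (x i) ∂(Measure.pi fun _ : Fin (M + 1) => μ)
      = ∫ x, min (mpQ π k 0 x) (mpQ π k i x) * h (x 0)
          ∂(Measure.pi fun _ : Fin (M + 1) => μ) := by
  rw [← integral_pi_comp_perm μ (Equiv.swap 0 i)]
  simp only [mpQ_comp_perm π k hk_symm, Function.comp_apply, Equiv.swap_apply_left,
    Equiv.swap_apply_right, min_comm]
end

section
/- Theorem 1, version 1 (unbiasedness of locally weighted MCMC with Metropolis-type weights): for every bounded measurable h : S → ℝ, Σ_{i=0}^{M} ∫_{S^{M+1}} w_i(x) · h(x_i) · q₀(x) dμ^{⊗(M+1)}(x) = ∫_S h(x) π(x) dμ(x). That is, if the current point x₀ is distributed according to π and the proposals x₁, …, x_M are drawn from k(·; x₀), the version 1 weighted estimator Σ_{i=0}^{M} w_i(x) h(x_i) is unbiased for ∫ h π dμ. -/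
open MeasureTheory

/-- The version 1 (Metropolis-type) weights:
`w_i(x) = (1/M) min{1, q_i(x)/q₀(x)}` for `1 ≤ i ≤ M` (with the convention
`min{1, c/0} = 1`) and `w₀(x) = 1 − Σ_{i=1}^M w_i(x)`. -/
noncomputable def mpW1 {S : Type*} {M : ℕ} (π : S → ℝ) (k : (Fin M → S) → S → ℝ)
    (i : Fin (M + 1)) (x : Fin (M + 1) → S) : ℝ :=
  let aux : Fin (M + 1) → ℝ := fun j =>
    (1 / (M : ℝ)) * (if mpQ π k 0 x = 0 then 1 else min 1 (mpQ π k j x / mpQ π k 0 x))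
  if i = 0 then 1 - ∑ j ∈ Finset.univ.erase 0, aux j else aux i

/-- Up to a reordering of `Fin M`, swapping `0` and `i` carries the indices other than `0` to the
indices other than `i`. -/
theorem exists_perm_swap_succAbove_zero {M : ℕ} (i : Fin (M + 1)) :
    ∃ σ : Equiv.Perm (Fin M), ∀ j,
      Equiv.swap 0 i ((0 : Fin (M + 1)).succAbove j) = i.succAbove (σ j) := by
  have hs : ∀ a : Fin (M + 1), a ≠ 0 ↔ Equiv.swap 0 i a ≠ i := fun a => by
    rw [not_iff_not, Equiv.swap_apply_eq_iff, Equiv.swap_apply_right]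
  refine ⟨((finSuccAboveEquiv 0).trans ((Equiv.swap 0 i).subtypeEquiv hs)).trans
    (finSuccAboveEquiv i).symm, fun j => ?_⟩
  have := congrArg Subtype.val ((finSuccAboveEquiv i).apply_symm_apply
    ((Equiv.swap 0 i).subtypeEquiv hs (finSuccAboveEquiv 0 j)))
  exact this.symm

section

variable {S : Type*} {M : ℕ} {π : S → ℝ} {k : (Fin M → S) → S → ℝ}

theorem mpQ_comp_swap
    (hk_symm : ∀ (σ : Equiv.Perm (Fin M)) (y : Fin M → S) (x : S), k (y ∘ σ) x = k y x)
    (i : Fin (M + 1)) (x : Fin (M + 1) → S) :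
    mpQ π k 0 (x ∘ Equiv.swap 0 i) = mpQ π k i x := by
  obtain ⟨σ, hσ⟩ := exists_perm_swap_succAbove_zero i
  simp only [mpQ, Function.comp_apply, Equiv.swap_apply_left, hσ]
  rw [← hk_symm σ (fun j => x (i.succAbove j))]
  rfl

theorem mpQ_nonneg (hπ : ∀ x, 0 ≤ π x) (hk : ∀ y x, 0 ≤ k y x)
    (i : Fin (M + 1)) (x : Fin (M + 1) → S) : 0 ≤ mpQ π k i x :=
  mul_nonneg (hπ _) (hk _ _)

theorem mpW1_mul_mpQ_zero (hπ : ∀ x, 0 ≤ π x) (hk : ∀ y x, 0 ≤ k y x)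
    {i : Fin (M + 1)} (hi : i ≠ 0) (x : Fin (M + 1) → S) :
    mpW1 π k i x * mpQ π k 0 x = 1 / (M : ℝ) * min (mpQ π k 0 x) (mpQ π k i x) := by
  have h0 := mpQ_nonneg hπ hk 0 x
  have hi' := mpQ_nonneg hπ hk i x
  simp only [mpW1, if_neg hi]
  split_ifs with h
  · simp [h, hi']
  · rw [mul_assoc, min_mul_of_nonneg _ _ h0, one_mul, div_mul_cancel₀ _ h]

theorem mpW1_zero (x : Fin (M + 1) → S) :
    mpW1 π k 0 x = 1 - ∑ j ∈ Finset.univ.erase 0, mpW1 π k j x := by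
  simp only [mpW1, if_true]
  congr 1
  exact Finset.sum_congr rfl fun j hj => (if_neg (Finset.ne_of_mem_erase hj)).symm

variable [MeasurableSpace S]

theorem measurable_mpQ (hπ : Measurable π)
    (hk : Measurable fun p : (Fin M → S) × S => k p.1 p.2) (i : Fin (M + 1)) :
    Measurable (mpQ π k i) :=
  (hπ.comp (measurable_pi_apply i)).mul
    (hk.comp (g := fun p : (Fin M → S) × S => k p.1 p.2)
      (f := fun x : Fin (M + 1) → S => (fun j => x (i.succAbove j), x i)) (by fun_prop))

variable {μ : Measure S} [SigmaFinite μ]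

theorem integral_comp_perm {ι : Type*} [Fintype ι] (e : Equiv.Perm ι) (f : (ι → S) → ℝ) :
    ∫ x, f (x ∘ e) ∂(Measure.pi fun _ => μ) = ∫ x, f x ∂(Measure.pi fun _ => μ) :=
  (measurePreserving_piCongrLeft (fun _ : ι => μ) e).symm.integral_comp' f

theorem integrable_prod_density (hπ_meas : Measurable π) (hπ : ∀ x, 0 ≤ π x)
    (hπ_int : Integrable π μ)
    (hk_meas : Measurable fun p : (Fin M → S) × S => k p.1 p.2) (hk : ∀ y x, 0 ≤ k y x)
    (hk_int : ∀ x : S, ∫ y, k y x ∂(Measure.pi fun _ : Fin M => μ) = 1) :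
    Integrable (fun p : S × (Fin M → S) => π p.1 * k p.2 p.1)
      (μ.prod (Measure.pi fun _ : Fin M => μ)) := by
  have hm : Measurable (fun p : S × (Fin M → S) => π p.1 * k p.2 p.1) :=
    (hπ_meas.comp measurable_fst).mul (hk_meas.comp measurable_swap)
  refine (integrable_prod_iff hm.aestronglyMeasurable).2
    ⟨.of_forall fun x => ?_, hπ_int.congr (.of_forall fun x => ?_)⟩
  · exact (Integrable.of_integral_ne_zero (by rw [hk_int x]; exact one_ne_zero)).const_mul (π x)
  · simp only [Real.norm_of_nonneg (mul_nonneg (hπ _) (hk _ _))]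
    rw [integral_const_mul, hk_int, mul_one]

theorem integrable_mpQ_zero (hπ_meas : Measurable π) (hπ : ∀ x, 0 ≤ π x)
    (hπ_int : Integrable π μ)
    (hk_meas : Measurable fun p : (Fin M → S) × S => k p.1 p.2) (hk : ∀ y x, 0 ≤ k y x)
    (hk_int : ∀ x : S, ∫ y, k y x ∂(Measure.pi fun _ : Fin M => μ) = 1) :
    Integrable (mpQ π k 0) (Measure.pi fun _ : Fin (M + 1) => μ) :=
  (measurePreserving_piFinSuccAbove (fun _ : Fin (M + 1) => μ) 0).integrable_comp_of_integrable
    (integrable_prod_density hπ_meas hπ hπ_int hk_meas hk hk_int)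

theorem integral_mul_mpQ_zero (hπ_meas : Measurable π) (hπ : ∀ x, 0 ≤ π x)
    (hπ_int : Integrable π μ)
    (hk_meas : Measurable fun p : (Fin M → S) × S => k p.1 p.2) (hk : ∀ y x, 0 ≤ k y x)
    (hk_int : ∀ x : S, ∫ y, k y x ∂(Measure.pi fun _ : Fin M => μ) = 1)
    {h : S → ℝ} (hh : Measurable h) {C : ℝ} (hC : ∀ x, |h x| ≤ C) :
    ∫ x, h (x 0) * mpQ π k 0 x ∂(Measure.pi fun _ : Fin (M + 1) => μ)
      = ∫ x, h x * π x ∂μ := by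
  have hint : Integrable (fun p : S × (Fin M → S) => h p.1 * (π p.1 * k p.2 p.1))
      (μ.prod (Measure.pi fun _ : Fin M => μ)) :=
    (integrable_prod_density hπ_meas hπ hπ_int hk_meas hk hk_int).bdd_mul (c := C)
      (hh.comp measurable_fst).aestronglyMeasurable (.of_forall fun p => hC p.1)
  refine ((measurePreserving_piFinSuccAbove (fun _ : Fin (M + 1) => μ) 0).integral_comp'
    (fun p : S × (Fin M → S) => h p.1 * (π p.1 * k p.2 p.1))).trans ?_
  rw [integral_prod _ hint]
  simp only [integral_const_mul, hk_int, mul_one]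

end

/-- Theorem 1, version 1: unbiasedness of locally weighted MCMC
with Metropolis-type weights.  For every bounded measurable `h : S → ℝ`,
`Σ_{i=0}^{M} ∫_{S^{M+1}} w_i(x) h(x_i) q₀(x) dμ^{⊗(M+1)}(x) = ∫_S h π dμ`:
if the current point `x₀` is distributed according to `π` and the proposals
are drawn from `k(·; x₀)`, the version 1 weighted estimator is unbiased. -/
theorem lwmcmc_version1_unbiased {S : Type*} [MeasurableSpace S]
    (μ : Measure S) [SigmaFinite μ]
    (π : S → ℝ) (hπ_meas : Measurable π) (hπ_nonneg : ∀ x, 0 ≤ π x)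
    (hπ_int : ∫ x, π x ∂μ = 1)
    (M : ℕ) (hM : 1 ≤ M)
    (k : (Fin M → S) → S → ℝ)
    (hk_meas : Measurable fun p : (Fin M → S) × S => k p.1 p.2)
    (hk_nonneg : ∀ y x, 0 ≤ k y x)
    (hk_int : ∀ x : S, ∫ y, k y x ∂(Measure.pi fun _ : Fin M => μ) = 1)
    (hk_symm : ∀ (σ : Equiv.Perm (Fin M)) (y : Fin M → S) (x : S), k (y ∘ σ) x = k y x)
    (h : S → ℝ) (hh_meas : Measurable h) (hh_bdd : ∃ C, ∀ x, |h x| ≤ C) :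
    ∑ i : Fin (M + 1),
        ∫ x, mpW1 π k i x * h (x i) * mpQ π k 0 x ∂(Measure.pi fun _ : Fin (M + 1) => μ)
      = ∫ x, h x * π x ∂μ := by
  obtain ⟨C, hC⟩ := hh_bdd
  have hπ : Integrable π μ := .of_integral_ne_zero (by rw [hπ_int]; exact one_ne_zero)
  have hQ := integrable_mpQ_zero hπ_meas hπ_nonneg hπ hk_meas hk_nonneg hk_int
  have hbdd : ∀ {f : (Fin (M + 1) → S) → ℝ} (j : Fin (M + 1)),
      Integrable f (Measure.pi fun _ => μ) →
        Integrable (fun x => h (x j) * f x) (Measure.pi fun _ => μ) := fun j hf =>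
    hf.bdd_mul (c := C) (hh_meas.comp (measurable_pi_apply j)).aestronglyMeasurable
      (.of_forall fun x => hC (x j))
  have hmin : ∀ j : Fin (M + 1),
      Integrable (fun x => 1 / (M : ℝ) * min (mpQ π k 0 x) (mpQ π k j x))
        (Measure.pi fun _ => μ) := fun j => by
    refine (hQ.mono' ((measurable_mpQ hπ_meas hk_meas 0).min
      (measurable_mpQ hπ_meas hk_meas j)).aestronglyMeasurable (.of_forall fun x => ?_)).const_mul _
    rw [Real.norm_of_nonneg (le_min (mpQ_nonneg hπ_nonneg hk_nonneg _ _)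
      (mpQ_nonneg hπ_nonneg hk_nonneg _ _))]
    exact min_le_left _ _
  have hswap : ∀ i ∈ Finset.univ.erase (0 : Fin (M + 1)),
      ∫ x, mpW1 π k i x * h (x i) * mpQ π k 0 x ∂(Measure.pi fun _ => μ)
        = ∫ x, h (x 0) * (1 / (M : ℝ) * min (mpQ π k 0 x) (mpQ π k i x))
            ∂(Measure.pi fun _ => μ) := fun i hi => by
    rw [← integral_comp_perm (Equiv.swap 0 i)
      (fun x => h (x 0) * (1 / (M : ℝ) * min (mpQ π k 0 x) (mpQ π k i x)))]
    refine integral_congr_ae (.of_forall fun x => ?_)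
    have hQi : mpQ π k i (x ∘ Equiv.swap 0 i) = mpQ π k 0 x := by
      rw [← mpQ_comp_swap hk_symm i, Function.comp_assoc]
      congr 1
      ext j
      simp
    simp only [mpQ_comp_swap hk_symm, hQi, Function.comp_apply, Equiv.swap_apply_left]
    rw [min_comm, ← mpW1_mul_mpQ_zero hπ_nonneg hk_nonneg (Finset.ne_of_mem_erase hi)]
    ring
  have hzero : ∀ x : Fin (M + 1) → S, mpW1 π k 0 x * h (x 0) * mpQ π k 0 x
      = h (x 0) * mpQ π k 0 x - ∑ i ∈ Finset.univ.erase 0,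
          h (x 0) * (1 / (M : ℝ) * min (mpQ π k 0 x) (mpQ π k i x)) := fun x => by
    rw [mpW1_zero, ← Finset.mul_sum, ← Finset.sum_congr rfl fun i hi =>
      mpW1_mul_mpQ_zero hπ_nonneg hk_nonneg (Finset.ne_of_mem_erase hi) x, ← Finset.sum_mul]
    ring
  rw [← Finset.add_sum_erase _ _ (Finset.mem_univ (0 : Fin (M + 1))), Finset.sum_congr rfl hswap]
  simp only [hzero]
  rw [integral_sub (hbdd 0 hQ) (integrable_finsetSum _ fun i _ => hbdd 0 (hmin i)),
    integral_finsetSum _ fun i _ => hbdd 0 (hmin i), sub_add_cancel,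
    integral_mul_mpQ_zero hπ_meas hπ_nonneg hπ hk_meas hk_nonneg hk_int hh_meas hC]
end
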